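/- A cubic graph is 3-edge-colorable if and only if it admits a (4,0)-flow, and in that case it admits an (r, (4−r)/2)-flow for every real r with 2≤r≤4. -/

import Mathlib

open Finset
open scoped Classical

namespace BEF

variable {V : Type*}

/-- An orientation of a simple graph: each edge gets exactly one direction. -/
structure Orientation (G : SimpleGraph V) where
  dir : V → V → Prop
  adj_of_dir : ∀ u v, dir u v → G.Adj u v
  dir_iff_not : ∀ u v, G.Adj u v → (dir u v ↔ ¬ dir v u)

/-- Net outflow (excess) of `f` at vertex `x` in orientation `D`. -/
noncomputable def excess [Fintype V] {G : SimpleGraph V}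
    (D : Orientation G) (f : Sym2 V → ℝ) (x : V) : ℝ :=
  (∑ y : V, if D.dir x y then f s(x, y) else 0)
    - (∑ y : V, if D.dir y x then f s(x, y) else 0)

/-- `f` is an `(r, α)`-bounded-excess flow in the orientation `D` of `G`. -/
def IsBEFlow [Fintype V] {G : SimpleGraph V}
    (D : Orientation G) (r α : ℝ) (f : Sym2 V → ℝ) : Prop :=
  (∀ e ∈ G.edgeSet, 1 ≤ f e ∧ f e ≤ r - 1) ∧ ∀ x : V, |excess D f x| ≤ α

/-- `G` admits an `(r, α)`-flow. -/
def HasFlow [Fintype V] (G : SimpleGraph V) (r α : ℝ) : Prop :=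
  ∃ D : Orientation G, ∃ f : Sym2 V → ℝ, IsBEFlow D r α f

/-- Outdegree of a vertex in an orientation. -/
noncomputable def outDeg {G : SimpleGraph V} (D : Orientation G) (x : V) : ℕ :=
  {y | D.dir x y}.ncard

/-- A cubic graph: every vertex has exactly 3 neighbours. -/
def IsCubic (G : SimpleGraph V) : Prop :=
  ∀ v : V, (G.neighborSet v).ncard = 3

/-- A bisection: a partition of the vertex set into two parts of equal size. -/
def IsBisection [Fintype V] (V₁ V₂ : Set V) : Prop :=
  Disjoint V₁ V₂ ∧ V₁ ∪ V₂ = Set.univ ∧ V₁.ncard = V₂.ncard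

/-- The bisection `(V₁, V₂)` of `G` is orientable. -/
def Orientable (G : SimpleGraph V) (V₁ V₂ : Set V) : Prop :=
  ∃ D : Orientation G, (∀ v ∈ V₁, outDeg D v = 1) ∧ (∀ v ∈ V₂, outDeg D v = 2)

/-- `d(A)`: the number of edges of `G` with exactly one endvertex in `A`. -/
noncomputable def cutCard (G : SimpleGraph V) (A : Set V) : ℕ :=
  {e ∈ G.edgeSet | ∃ u ∈ A, ∃ v ∉ A, e = s(u, v)}.ncard

/-- `Δ(A) = | |V₂ ∩ A| - |V₁ ∩ A| |` (as an integer). -/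
noncomputable def disc (V₁ V₂ A : Set V) : ℤ :=
  |((V₂ ∩ A).ncard : ℤ) - ((V₁ ∩ A).ncard : ℤ)|

/-- Every connected component of the subgraph induced on `S` is a tree on
at most `k - 2` vertices. -/
def WeakSide (G : SimpleGraph V) (k : ℕ) (S : Set V) : Prop :=
  (G.induce S).IsAcyclic ∧
    ∀ c : (G.induce S).ConnectedComponent, c.supp.ncard ≤ k - 2

/-- A `k`-weak bisection. -/
def KWeak [Fintype V] (G : SimpleGraph V) (k : ℕ) (V₁ V₂ : Set V) : Prop :=
  IsBisection V₁ V₂ ∧ WeakSide G k V₁ ∧ WeakSide G k V₂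

/-- A balanced orientation: every outdegree is 1 or 2. -/
def Balanced {G : SimpleGraph V} (D : Orientation G) : Prop :=
  ∀ v : V, outDeg D v = 1 ∨ outDeg D v = 2

/-- A proper 3-edge-colouring of `G`. -/
def ThreeEdgeColorable (G : SimpleGraph V) : Prop :=
  ∃ c : Sym2 V → Fin 3, ∀ e₁ ∈ G.edgeSet, ∀ e₂ ∈ G.edgeSet,
    e₁ ≠ e₂ → (∃ v, v ∈ e₁ ∧ v ∈ e₂) → c e₁ ≠ c e₂

/-- The net flow carried from `x` to `y`. -/
noncomputable def netFlow {G : SimpleGraph V} (D : Orientation G) (f : Sym2 V → ℝ)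
    (x y : V) : ℝ :=
  if D.dir x y then f s(x, y) else if D.dir y x then -f s(x, y) else 0

theorem Orientation.not_dir_of_dir {G : SimpleGraph V} (D : Orientation G) {x y : V}
    (h : D.dir x y) : ¬ D.dir y x :=
  (D.dir_iff_not x y (D.adj_of_dir x y h)).1 h

theorem excess_eq_sum_netFlow [Fintype V] {G : SimpleGraph V} (D : Orientation G)
    (f : Sym2 V → ℝ) (x : V) : excess D f x = ∑ y, netFlow D f x y := by
  unfold excess netFlow
  rw [← Finset.sum_sub_distrib]
  refine Finset.sum_congr rfl fun y _ => ?_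
  by_cases h : D.dir x y
  · simp [h, D.not_dir_of_dir h]
  · by_cases h' : D.dir y x <;> simp [h, h']

/-- In a cubic graph, sums of functions supported on a neighbourhood have three terms. -/
theorem IsCubic.exists_neighbors [Fintype V] {G : SimpleGraph V} (hG : IsCubic G) (x : V) :
    ∃ a b c, a ≠ b ∧ a ≠ c ∧ b ≠ c ∧ (∀ y, G.Adj x y ↔ y = a ∨ y = b ∨ y = c) ∧
      ∀ g : V → ℝ, (∀ y, ¬ G.Adj x y → g y = 0) → ∑ y, g y = g a + g b + g c := by
  obtain ⟨a, b, c, hab, hac, hbc, h⟩ := Set.ncard_eq_three.1 (hG x)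
  have hadj : ∀ y, G.Adj x y ↔ y = a ∨ y = b ∨ y = c := fun y => by
    rw [← SimpleGraph.mem_neighborSet, h]; simp
  refine ⟨a, b, c, hab, hac, hbc, hadj, fun g hg => ?_⟩
  rw [← Finset.sum_subset (Finset.subset_univ {a, b, c})]
  · rw [Finset.sum_insert (by simp [hab, hac]), Finset.sum_pair hbc, add_assoc]
  · intro y _ hy
    exact hg y fun hxy => hy (by simpa using (hadj y).1 hxy)

theorem netFlow_eq_zero {G : SimpleGraph V} (D : Orientation G) (f : Sym2 V → ℝ) {x y : V}
    (h : ¬ G.Adj x y) : netFlow D f x y = 0 := by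
  have h₁ : ¬ D.dir x y := fun hd => h (D.adj_of_dir _ _ hd)
  have h₂ : ¬ D.dir y x := fun hd => h (D.adj_of_dir _ _ hd).symm
  simp [netFlow, h₁, h₂]

/-- A doubly stochastic matrix is positive along some permutation. -/
theorem exists_perm_pos [Fintype V] (W : Matrix V V ℝ) (hW : W ∈ doublyStochastic ℝ V) :
    ∃ σ : Equiv.Perm V, ∀ x, 0 < W x (σ x) := by
  obtain ⟨w, hw, hw1, hsum⟩ := exists_eq_sum_perm_of_mem_doublyStochastic hW
  obtain ⟨σ, -, hσ⟩ : ∃ σ ∈ Finset.univ, 0 < w σ := by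
    by_contra! h
    have := Finset.sum_nonpos h
    linarith
  refine ⟨σ, fun x => hσ.trans_le ?_⟩
  rw [← hsum, Matrix.sum_apply]
  refine le_trans ?_ (Finset.single_le_sum (f := fun τ : Equiv.Perm V =>
    (w τ • τ.permMatrix ℝ) x (σ x)) (fun τ _ => ?_) (Finset.mem_univ σ))
  · simp [Equiv.Perm.permMatrix, PEquiv.toMatrix_apply]
  · have : 0 ≤ τ.permMatrix ℝ x (σ x) := by
      simp only [Equiv.Perm.permMatrix, PEquiv.toMatrix_apply]
      split_ifs <;> norm_num
    simpa using mul_nonneg (hw τ) this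

theorem eq_of_weight_eq_one [Fintype V] {w : V → ℝ} (h0 : ∀ y, 0 ≤ w y) (hsum : ∑ y, w y = 1)
    {y z : V} (hy : w y = 1) (hz : 0 < w z) : z = y := by
  by_contra hne
  have h1 : ∑ t ∈ {y, z}, w t ≤ ∑ t, w t :=
    Finset.sum_le_sum_of_subset_of_nonneg (Finset.subset_univ _) fun t _ _ => h0 t
  rw [Finset.sum_pair (Ne.symm hne), hsum] at h1
  linarith

/-- A fractional perfect matching whose support is bipartite up to edges of weight one
contains a perfect matching in its support. -/
theorem exists_involution_pos [Fintype V] (W : V → V → ℝ) (S : V → Prop)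
    (h0 : ∀ x y, 0 ≤ W x y) (hsymm : ∀ x y, W x y = W y x) (hsum : ∀ x, ∑ y, W x y = 1)
    (hS : ∀ x y, 0 < W x y → (S x ↔ S y) → W x y = 1) :
    ∃ m : V → V, (∀ x, m (m x) = x) ∧ ∀ x, 0 < W x (m x) := by
  obtain ⟨σ, hσ⟩ := exists_perm_pos (Matrix.of W) (by
    rw [mem_doublyStochastic_iff_sum]
    refine ⟨h0, hsum, fun y => ?_⟩
    simp only [Matrix.of_apply, hsymm _ y, hsum])
  simp only [Matrix.of_apply] at hσ
  have huniq : ∀ x y z, W x y = 1 → 0 < W x z → z = y := fun x _ _ =>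
    eq_of_weight_eq_one (h0 x) (hsum x)
  have hinv : ∀ x, 0 < W x (σ.symm x) := fun x => by
    have := hσ (σ.symm x)
    rwa [Equiv.apply_symm_apply, hsymm] at this
  refine ⟨fun x => if S x then σ x else σ.symm x, fun x => ?_, fun x => ?_⟩
  · by_cases hx : S x
    · by_cases hy : S (σ x)
      · have h1 := hS _ _ (hσ x) (by tauto)
        rw [hsymm] at h1
        simpa [hx, hy] using huniq _ _ _ h1 (hσ (σ x))
      · simp [hx, hy]
    · by_cases hy : S (σ.symm x)
      · simp [hx, hy]
      · have h1 := hS _ _ (hinv x) (by tauto)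
        rw [hsymm] at h1
        simpa [hx, hy] using huniq _ _ _ h1 (hinv (σ.symm x))
  · dsimp only
    split_ifs
    exacts [hσ x, hinv x]

/-- The union of two perfect matchings is bipartite. -/
theorem exists_sign_of_involutions [Fintype V] (a b : V → V) (ha : ∀ x, a (a x) = x)
    (hb : ∀ x, b (b x) = x) (ha' : ∀ x, a x ≠ x) (hb' : ∀ x, b x ≠ x) :
    ∃ g : V → ℝ, (∀ x, g x = 1 ∨ g x = -1) ∧ (∀ x, g (a x) = -g x) ∧ ∀ x, g (b x) = -g x := by
  let A : Equiv.Perm V := Function.Involutive.toPerm a ha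
  let B : Equiv.Perm V := Function.Involutive.toPerm b hb
  let P : Equiv.Perm V := A * B
  have hAA : A⁻¹ = A := Function.Involutive.toPerm_symm ha
  have hBB : B⁻¹ = B := Function.Involutive.toPerm_symm hb
  have hconj : A * P * A⁻¹ = P⁻¹ := by
    have hA2 : A * A = 1 := Equiv.ext ha
    rw [mul_inv_rev, hAA, hBB, ← mul_assoc, hA2, one_mul]
  have hconj' : ∀ (k : ℤ) x, a ((P ^ k) x) = (P ^ (-k)) (a x) := by
    intro k x
    have h : A * P ^ k * A⁻¹ = P ^ (-k) := by
      rw [← conj_zpow, hconj, inv_zpow, zpow_neg]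
    rw [← h, hAA]
    change _ = a ((P ^ k) (a (a x)))
    rw [ha]
  have hne : ∀ x, ¬ P.SameCycle x (a x) := by
    rintro x ⟨k, hk⟩
    obtain ⟨m, rfl | rfl⟩ := Int.even_or_odd' k
    · refine ha' ((P ^ m) x) ?_
      rw [hconj', ← hk, ← Equiv.Perm.mul_apply, ← zpow_add]
      congr 2
      ring
    · refine hb' ((P ^ m) x) ?_
      have h1 : a ((P ^ m) x) = a (b ((P ^ m) x)) := by
        change _ = P ((P ^ m) x)
        rw [hconj', ← hk, ← Equiv.Perm.mul_apply, ← Equiv.Perm.mul_apply, ← zpow_add,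
          ← zpow_one_add]
        congr 2
        ring
      have h2 := congrArg a h1
      rw [ha, ha] at h2
      exact h2.symm
  have hsame : ∀ x y, P.SameCycle x y → P.SameCycle (a x) (a y) := by
    rintro x y ⟨k, rfl⟩
    exact ⟨-k, (hconj' k x).symm⟩
  let Q := Quotient (Equiv.Perm.SameCycle.setoid P)
  let q : V → Q := Quotient.mk _
  have hq : ∀ x y, q x = q y ↔ P.SameCycle x y := fun x y => Quotient.eq
  let e := Fintype.equivFin Q
  have hqa : ∀ x, e (q x) ≠ e (q (a x)) := fun x h => hne x ((hq _ _).1 (e.injective h))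
  have hqb : ∀ x, q (b x) = q (a x) := fun x => by
    rw [hq]
    have h : P.SameCycle x (P x) := ⟨1, by simp⟩
    have h' := hsame _ _ h
    have hP : a (P x) = b x := ha (b x)
    rw [hP] at h'
    exact h'.symm
  have hqab : ∀ x, q (a (b x)) = q x := fun x => by
    rw [hq]
    exact Equiv.Perm.SameCycle.symm ⟨1, by rw [zpow_one]; rfl⟩
  refine ⟨fun x => if e (q x) < e (q (a x)) then 1 else -1, fun x => ?_, fun x => ?_, fun x => ?_⟩
  · dsimp only
    split_ifs <;> simp
  · have := hqa x
    simp only [ha]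
    rcases lt_or_gt_of_ne this with h | h
    · simp [h, h.not_gt]
    · simp [h, h.not_gt]
  · have := hqa x
    simp only [hqb, hqab]
    rcases lt_or_gt_of_ne this with h | h
    · simp [h, h.not_gt]
    · simp [h, h.not_gt]

/-- In a properly 3-edge-coloured cubic graph, any two colour classes form a bipartite graph. -/
theorem exists_sign_of_coloring [Fintype V] {G : SimpleGraph V} (hG : IsCubic G)
    (c : Sym2 V → Fin 3)
    (hc : ∀ x y z, G.Adj x y → G.Adj x z → y ≠ z → c s(x, y) ≠ c s(x, z))
    (i j : Fin 3) :
    ∃ g : V → ℝ, (∀ x, g x = 1 ∨ g x = -1) ∧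
      ∀ x y, G.Adj x y → c s(x, y) = i ∨ c s(x, y) = j → g y = -g x := by
  have hex : ∀ (k : Fin 3) x, ∃ y, G.Adj x y ∧ c s(x, y) = k := by
    intro k x
    obtain ⟨a, b, d, hab, had, hbd, hadj, -⟩ := hG.exists_neighbors x
    have h1 : G.Adj x a := (hadj a).2 (by simp)
    have h2 : G.Adj x b := (hadj b).2 (by simp)
    have h3 : G.Adj x d := (hadj d).2 (by simp)
    have n1 := hc x a b h1 h2 hab
    have n2 := hc x a d h1 h3 had
    have n3 := hc x b d h2 h3 hbd
    have : c s(x, a) = k ∨ c s(x, b) = k ∨ c s(x, d) = k := by omega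
    rcases this with h | h | h
    exacts [⟨a, h1, h⟩, ⟨b, h2, h⟩, ⟨d, h3, h⟩]
  choose n hn hnc using hex
  have huniq : ∀ k x y, G.Adj x y → c s(x, y) = k → n k x = y := by
    intro k x y hxy hk
    by_contra h
    exact hc x _ _ (hn k x) hxy h ((hnc k x).trans hk.symm)
  have hinv : ∀ k x, n k (n k x) = x := fun k x =>
    huniq k _ _ (hn k x).symm (by rw [Sym2.eq_swap]; exact hnc k x)
  obtain ⟨g, hg, hi, hj⟩ := exists_sign_of_involutions (n i) (n j) (hinv i) (hinv j)
    (fun x => (hn i x).ne') (fun x => (hn j x).ne')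
  refine ⟨g, hg, fun x y hxy h => ?_⟩
  rcases h with h | h
  · rw [← huniq i x y hxy h, hi]
  · rw [← huniq j x y hxy h, hj]

/-- An antisymmetric function with absolute values in `[1, r - 1]` on edges, supported on the
edges and with zero row sums gives an `(r, 0)`-flow. -/
theorem hasFlow_of_antisymm [Fintype V] {G : SimpleGraph V} {r : ℝ} (φ : V → V → ℝ)
    (hanti : ∀ x y, φ y x = -φ x y) (hsupp : ∀ x y, ¬ G.Adj x y → φ x y = 0)
    (hbd : ∀ x y, G.Adj x y → 1 ≤ |φ x y| ∧ |φ x y| ≤ r - 1) (hsum : ∀ x, ∑ y, φ x y = 0) :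
    HasFlow G r 0 := by
  have hne : ∀ x y, G.Adj x y → φ x y ≠ 0 := fun x y h h0 => by
    have := (hbd x y h).1
    rw [h0, abs_zero] at this
    linarith
  let D : Orientation G :=
    { dir := fun x y => 0 < φ x y
      adj_of_dir := fun x y h => by
        by_contra hxy
        exact h.ne' (hsupp x y hxy)
      dir_iff_not := fun x y h => by
        rw [hanti x y, not_lt, neg_nonpos]
        exact ⟨le_of_lt, fun h' => lt_of_le_of_ne h' (hne x y h).symm⟩ }
  let f : Sym2 V → ℝ := Sym2.lift ⟨fun x y => |φ x y|, fun x y => by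
    dsimp only
    rw [hanti x y, abs_neg]⟩
  refine ⟨D, f, ?_, fun x => ?_⟩
  · intro e
    induction e using Sym2.ind with
    | _ x y => exact fun h => hbd x y h
  · rw [excess_eq_sum_netFlow, Finset.sum_congr rfl fun y _ => ?_, hsum x, abs_zero]
    change (if 0 < φ x y then |φ x y| else if 0 < φ y x then -|φ x y| else 0) = φ x y
    rw [hanti x y]
    split_ifs with h h'
    · exact abs_of_pos h
    · rw [abs_of_neg (by linarith), neg_neg]
    · linarith

theorem ThreeEdgeColorable.hasFlow_four [Fintype V] {G : SimpleGraph V} (hG : IsCubic G)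
    (h : ThreeEdgeColorable G) : HasFlow G 4 0 := by
  obtain ⟨c, hc⟩ := h
  replace hc : ∀ x y z, G.Adj x y → G.Adj x z → y ≠ z → c s(x, y) ≠ c s(x, z) := by
    intro x y z hy hz hyz
    exact hc _ hy _ hz (fun h => hyz (Sym2.congr_right.1 h)) ⟨x, by simp, by simp⟩
  obtain ⟨g, hg, hg'⟩ := exists_sign_of_coloring hG c hc 0 1
  obtain ⟨k, hk, hk'⟩ := exists_sign_of_coloring hG c hc 1 2
  let ψ : V → Fin 3 → ℝ := fun x => ![g x, -g x + 2 * k x, -(2 * k x)]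
  have hcol : ∀ i : Fin 3, i = 0 ∨ i = 1 ∨ i = 2 := by decide
  refine hasFlow_of_antisymm (fun x y => if G.Adj x y then ψ x (c s(x, y)) else 0) ?_ ?_ ?_ ?_
  · intro x y
    by_cases hxy : G.Adj x y
    · simp only [hxy, hxy.symm, if_true, Sym2.eq_swap (a := y) (b := x)]
      have h1 := hg' x y hxy
      have h2 := hk' x y hxy
      rcases hcol (c s(x, y)) with h | h | h <;> simp [h] at h1 h2 <;> simp [ψ, *] <;> ring
    · have hyx : ¬ G.Adj y x := fun h => hxy h.symm
      simp [hxy, hyx]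
  · intro x y hxy
    simp [hxy]
  · intro x y hxy
    simp only [hxy, if_true]
    rcases hcol (c s(x, y)) with h | h | h <;> rcases hg x with h1 | h1 <;>
      rcases hk x with h2 | h2 <;> simp [ψ, h, h1, h2] <;> norm_num [abs]
  · intro x
    obtain ⟨a, b, d, hab, had, hbd, hadj, hsum⟩ := hG.exists_neighbors x
    have h1 : G.Adj x a := (hadj a).2 (by simp)
    have h2 : G.Adj x b := (hadj b).2 (by simp)
    have h3 : G.Adj x d := (hadj d).2 (by simp)
    have n1 := hc x a b h1 h2 hab
    have n2 := hc x a d h1 h3 had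
    have n3 := hc x b d h2 h3 hbd
    rw [hsum _ fun y hy => by simp [hy]]
    simp only [h1, h2, h3, if_true]
    generalize c s(x, a) = p at *
    generalize c s(x, b) = q at *
    generalize c s(x, d) = t at *
    rcases hcol p with rfl | rfl | rfl <;> rcases hcol q with rfl | rfl | rfl <;>
      rcases hcol t with rfl | rfl | rfl <;>
      first
      | exact absurd rfl n1
      | exact absurd rfl n2
      | exact absurd rfl n3
      | (simp [ψ]; try ring)

/-- The unit flow along an orientation carrying a positive flow without excess has excess at most
one at every vertex of a cubic graph. -/
theorem abs_excess_one_le [Fintype V] {G : SimpleGraph V} (hG : IsCubic G) {D : Orientation G}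
    {r : ℝ} {f : Sym2 V → ℝ} (hf : IsBEFlow D r 0 f) (x : V) :
    |excess D (fun _ => 1) x| ≤ 1 := by
  obtain ⟨a, b, d, -, -, -, hadj, hsum⟩ := hG.exists_neighbors x
  have h1 : G.Adj x a := (hadj a).2 (by simp)
  have h2 : G.Adj x b := (hadj b).2 (by simp)
  have h3 : G.Adj x d := (hadj d).2 (by simp)
  have e0 := abs_nonpos_iff.1 (hf.2 x)
  rw [excess_eq_sum_netFlow, hsum _ fun y hy => netFlow_eq_zero D f hy] at e0
  rw [excess_eq_sum_netFlow, hsum _ fun y hy => netFlow_eq_zero D _ hy]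
  have f1 := (hf.1 s(x, a) h1).1
  have f2 := (hf.1 s(x, b) h2).1
  have f3 := (hf.1 s(x, d) h3).1
  have d1 := D.dir_iff_not x a h1
  have d2 := D.dir_iff_not x b h2
  have d3 := D.dir_iff_not x d h3
  by_cases c1 : D.dir x a <;> by_cases c2 : D.dir x b <;> by_cases c3 : D.dir x d <;>
    simp only [c1, c2, c3, true_iff, false_iff, not_not] at d1 d2 d3 <;>
    simp only [netFlow, c1, c2, c3, d1, d2, d3, if_true, if_false] at e0 ⊢ <;>
    first
    | (exfalso; linarith)
    | norm_num

theorem HasFlow.interpolate [Fintype V] {G : SimpleGraph V} (hG : IsCubic G)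
    (h : HasFlow G 4 0) {r : ℝ} (h2 : 2 ≤ r) (h4 : r ≤ 4) : HasFlow G r ((4 - r) / 2) := by
  obtain ⟨D, f, hf⟩ := h
  refine ⟨D, fun e => (4 - r) / 2 + (r - 2) / 2 * f e, fun e he => ?_, fun x => ?_⟩
  · obtain ⟨l, u⟩ := hf.1 e he
    constructor <;> nlinarith
  · have e0 := abs_nonpos_iff.1 (hf.2 x)
    have e1 := abs_excess_one_le hG hf x
    have key : excess D (fun e => (4 - r) / 2 + (r - 2) / 2 * f e) x =
        (4 - r) / 2 * excess D (fun _ => 1) x + (r - 2) / 2 * excess D f x := by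
      simp only [excess_eq_sum_netFlow, Finset.mul_sum, ← Finset.sum_add_distrib]
      refine Finset.sum_congr rfl fun y _ => ?_
      unfold netFlow
      split_ifs <;> ring
    rw [key, e0, mul_zero, add_zero, abs_mul, abs_of_nonneg (by linarith)]
    nlinarith

/-- A vertex is merging if more edges enter it than leave it. -/
def IsMerging [Fintype V] {G : SimpleGraph V} (D : Orientation G) (x : V) : Prop :=
  excess D (fun _ => 1) x < 0

/-- The fractional perfect matching attached to a `(4, 0)`-flow of a cubic graph. The weight of an
edge is `3 - f` if it is the only outgoing or the only incoming edge at `x`, else `f - 1`. -/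
noncomputable def matchingWeight [Fintype V] {G : SimpleGraph V} (D : Orientation G)
    (f : Sym2 V → ℝ) (x y : V) : ℝ :=
  if G.Adj x y then
    if (IsMerging D x ↔ D.dir x y) then 3 - f s(x, y) else f s(x, y) - 1
  else 0

theorem matchingWeight_nonneg [Fintype V] {G : SimpleGraph V} {D : Orientation G}
    {f : Sym2 V → ℝ} {α : ℝ} (hf : IsBEFlow D 4 α f) (x y : V) : 0 ≤ matchingWeight D f x y := by
  unfold matchingWeight
  split_ifs with h1 h2
  · linarith [(hf.1 s(x, y) h1).2]
  · linarith [(hf.1 s(x, y) h1).1]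
  · rfl

/-- Local structure of a `(4, 0)`-flow at a vertex of a cubic graph. -/
theorem matchingWeight_local [Fintype V] {G : SimpleGraph V} (hG : IsCubic G) {D : Orientation G}
    {f : Sym2 V → ℝ} (hf : IsBEFlow D 4 0 f) (x : V) :
    ∑ y, matchingWeight D f x y = 1 ∧
      ∀ y, G.Adj x y → if (IsMerging D x ↔ D.dir x y) then 2 ≤ f s(x, y) else f s(x, y) ≤ 2 := by
  obtain ⟨a, b, d, -, -, -, hadj, hsum⟩ := hG.exists_neighbors x
  have h1 : G.Adj x a := (hadj a).2 (by simp)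
  have h2 : G.Adj x b := (hadj b).2 (by simp)
  have h3 : G.Adj x d := (hadj d).2 (by simp)
  have e0 := abs_nonpos_iff.1 (hf.2 x)
  rw [excess_eq_sum_netFlow, hsum _ fun y hy => netFlow_eq_zero D f hy] at e0
  have hm : IsMerging D x ↔ netFlow D (fun _ => 1) x a + netFlow D (fun _ => 1) x b +
      netFlow D (fun _ => 1) x d < 0 := by
    rw [IsMerging, excess_eq_sum_netFlow, hsum _ fun y hy => netFlow_eq_zero D _ hy]
  rw [hsum _ fun y hy => by simp [matchingWeight, hy]]
  have f1 := hf.1 s(x, a) h1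
  have f2 := hf.1 s(x, b) h2
  have f3 := hf.1 s(x, d) h3
  have d1 := D.dir_iff_not x a h1
  have d2 := D.dir_iff_not x b h2
  have d3 := D.dir_iff_not x d h3
  have hall : ∀ p : V → Prop, (∀ y, G.Adj x y → p y) ↔ p a ∧ p b ∧ p d := fun p => by
    simp [hadj]
  rw [hall]
  simp only [matchingWeight, h1, h2, h3, if_true]
  by_cases c1 : D.dir x a <;> by_cases c2 : D.dir x b <;> by_cases c3 : D.dir x d <;>
    simp only [c1, c2, c3, true_iff, false_iff, not_not] at d1 d2 d3 <;>
    simp only [netFlow, c1, c2, c3, d1, d2, d3, if_true, if_false] at e0 hm <;>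
    norm_num at hm <;>
    simp only [hm, c1, c2, c3, iff_true, iff_false, not_true, if_true, if_false] <;>
    (refine ⟨?_, ?_, ?_, ?_⟩ <;> linarith)

theorem matchingWeight_symm_and [Fintype V] {G : SimpleGraph V} (hG : IsCubic G)
    {D : Orientation G} {f : Sym2 V → ℝ} (hf : IsBEFlow D 4 0 f) {x y : V} (h : G.Adj x y) :
    matchingWeight D f x y = matchingWeight D f y x ∧
      ((IsMerging D x ↔ IsMerging D y) → matchingWeight D f x y = 1) := by
  have hx := (matchingWeight_local hG hf x).2 y h
  have hy := (matchingWeight_local hG hf y).2 x h.symm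
  have hd := D.dir_iff_not x y h
  simp only [matchingWeight, h, h.symm, if_true]
  rw [Sym2.eq_swap (a := y) (b := x)] at *
  by_cases c1 : IsMerging D x <;> by_cases c2 : IsMerging D y <;> by_cases c3 : D.dir x y <;>
    by_cases c4 : D.dir y x <;> simp [c1, c2, c3, c4] at hx hy hd ⊢ <;>
    first
    | linarith
    | constructor <;> linarith

theorem HasFlow.threeEdgeColorable [Fintype V] {G : SimpleGraph V} (hG : IsCubic G)
    (h : HasFlow G 4 0) : ThreeEdgeColorable G := by
  obtain ⟨D, f, hf⟩ := h
  have hadj : ∀ x y, 0 < matchingWeight D f x y → G.Adj x y := fun x y h => by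
    by_contra hxy
    simp [matchingWeight, hxy] at h
  obtain ⟨m, hm, hmW⟩ := exists_involution_pos (matchingWeight D f) (IsMerging D)
    (matchingWeight_nonneg hf)
    (fun x y => by
      by_cases h : G.Adj x y
      · exact (matchingWeight_symm_and hG hf h).1
      · have h' : ¬ G.Adj y x := fun h' => h h'.symm
        simp [matchingWeight, h, h'])
    (fun x => (matchingWeight_local hG hf x).1)
    (fun x y h => (matchingWeight_symm_and hG hf (hadj x y h)).2)
  have hmadj : ∀ x, G.Adj x (m x) := fun x => hadj _ _ (hmW x)
  have hmono : ∀ x y, G.Adj x y → (IsMerging D x ↔ IsMerging D y) → y = m x := by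
    intro x y hxy hS
    exact (eq_of_weight_eq_one (matchingWeight_nonneg hf x) (matchingWeight_local hG hf x).1
      ((matchingWeight_symm_and hG hf hxy).2 hS) (hmW x)).symm
  obtain ⟨n, hn, hnW⟩ := exists_involution_pos
    (fun x y => if G.Adj x y ∧ y ≠ m x then (1 / 2 : ℝ) else 0) (IsMerging D)
    (fun x y => by split_ifs <;> norm_num)
    (fun x y => by
      have : (G.Adj x y ∧ y ≠ m x) ↔ (G.Adj y x ∧ x ≠ m y) := by
        rw [G.adj_comm]
        refine and_congr_right fun _ => not_congr ⟨?_, ?_⟩ <;> rintro rfl <;> simp [hm]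
      simp only [this])
    (fun x => by
      obtain ⟨a, b, d, hab, had, hbd, hx, hsum⟩ := hG.exists_neighbors x
      rw [hsum _ fun y hy => by simp [hy]]
      have h1 : G.Adj x a := (hx a).2 (by simp)
      have h2 : G.Adj x b := (hx b).2 (by simp)
      have h3 : G.Adj x d := (hx d).2 (by simp)
      simp only [h1, h2, h3, true_and]
      rcases (hx _).1 (hmadj x) with h | h | h <;> rw [h] <;>
        simp [hab, had, hbd, hab.symm, had.symm, hbd.symm] <;> norm_num)
    (fun x y h hS => by
      split_ifs at h with h'
      · exact absurd (hmono x y h'.1 hS) h'.2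
      · exact absurd h (lt_irrefl _))
  have hnadj : ∀ x, G.Adj x (n x) ∧ n x ≠ m x := fun x => by
    by_contra h
    have := hnW x
    rw [if_neg h] at this
    exact lt_irrefl _ this
  have hsw : ∀ (k : V → V), (∀ x, k (k x) = x) → ∀ x y, k x = y ↔ k y = x :=
    fun k hk x y => ⟨fun h => h ▸ hk x, fun h => h ▸ hk y⟩
  let c : Sym2 V → Fin 3 := Sym2.lift ⟨fun x y => if m x = y then 0 else if n x = y then 1 else 2,
    fun x y => by simp only [hsw m hm x y, hsw n hn x y]⟩
  refine ⟨c, ?_⟩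
  rintro e₁ h₁ e₂ h₂ hne ⟨v, hv₁, hv₂⟩
  obtain ⟨y, rfl⟩ := hv₁
  obtain ⟨z, rfl⟩ := hv₂
  have hyz : y ≠ z := fun h => hne (by rw [h])
  change (if m v = y then (0 : Fin 3) else if n v = y then 1 else 2) ≠
    if m v = z then (0 : Fin 3) else if n v = z then 1 else 2
  obtain ⟨a, b, d, hab, had, hbd, hx, -⟩ := hG.exists_neighbors v
  have hy := (hx y).1 h₁
  have hz := (hx z).1 h₂
  have hmv := (hx _).1 (hmadj v)
  have hnv := (hx _).1 (hnadj v).1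
  have hnm := (hnadj v).2
  split_ifs <;> grind

/-- a cubic graph is 3-edge-colourable iff it admits a `(4,0)`-flow, in
which case it admits an `(r, (4-r)/2)`-flow for all `2 ≤ r ≤ 4`. -/
theorem stmt12 [Fintype V] (G : SimpleGraph V) (hG : IsCubic G) :
    (ThreeEdgeColorable G ↔ HasFlow G 4 0) ∧
    (ThreeEdgeColorable G → ∀ r : ℝ, 2 ≤ r → r ≤ 4 → HasFlow G r ((4 - r) / 2)) := by
  refine ⟨⟨fun h => h.hasFlow_four hG, fun h => h.threeEdgeColorable hG⟩, fun h r h2 h4 => ?_⟩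
  exact (h.hasFlow_four hG).interpolate hG h2 h4

end BEF
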